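/- Let C_1 and C_2 be knot-like complexes which are locally equivalent via local maps f: C_1 → C_2 and g: C_2 → C_1. Then f and g also induce isomorphisms on H_*(·/V)/(U-torsion); in particular, f and g send U-tower classes to U-tower classes and are absolutely V-graded. -/

import Mathlib

/-!
Common setup: the ring `R = 𝔽₂[U,V]/(UV = 0)`, bigraded free finitely generated chain
complexes over `R` ("pre-complexes"), knot-like complexes, local maps and local
equivalence, standard and semistandard complexes, short maps, the `Z^!` order,
the invariants `a_i`, `φ_j`, `P`, shift maps, tensor products, duals, and direct sums.
-/

set_option synthInstance.maxHeartbeats 1000000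
set_option maxHeartbeats 1000000

noncomputable section

/-- The polynomial ring `𝔽₂[U,V]`. -/
abbrev PolyUV : Type := MvPolynomial (Fin 2) (ZMod 2)

/-- The ideal `(U·V)`. -/
def IUV : Ideal PolyUV := Ideal.span {(MvPolynomial.X 0 * MvPolynomial.X 1 : PolyUV)}

/-- The ring `R = 𝔽₂[U,V]/(UV = 0)`. -/
abbrev RUV : Type := PolyUV ⧸ IUV

instance : CommRing RUV := Ideal.Quotient.commRing IUV

/-- The image of `U` in `R`. -/
def Uv : RUV := Ideal.Quotient.mk IUV (MvPolynomial.X 0)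

/-- The image of `V` in `R`. -/
def Vv : RUV := Ideal.Quotient.mk IUV (MvPolynomial.X 1)

/-- `r ∈ R` is homogeneous of bidegree `(p, q)` for the bigrading with
`gr(U) = (-2, 0)`, `gr(V) = (0, -2)`, `gr(1) = (0, 0)` (coefficients in `𝔽₂`). -/
def IsHomog (r : RUV) (p q : ℤ) : Prop :=
  r = 0 ∨ (∃ a : ℕ, r = Uv ^ a ∧ p = -(2 * (a : ℤ)) ∧ q = 0) ∨
    (∃ b : ℕ, r = Vv ^ b ∧ p = 0 ∧ q = -(2 * (b : ℤ)))

/-- A finitely generated free bigraded module over `R` with a distinguished basis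
indexed by `Fin n`, together with a bigrading `gr` on the basis and a matrix `dm`
recording a prospective differential: `dm i j` is the coefficient of the `j`-th basis
vector in the differential of the `i`-th basis vector. -/
structure PreCx where
  n : ℕ
  gr : Fin n → ℤ × ℤ
  dm : Fin n → Fin n → RUV

/-- The underlying free `R`-module of a pre-complex. -/
abbrev Msub (C : PreCx) : Type := Fin C.n →₀ RUV

/-- The differential of a pre-complex, as an `R`-linear map. -/
def dmap (C : PreCx) : Msub C →ₗ[RUV] Msub C :=
  Finsupp.linearCombination RUV fun i => ∑ j, Finsupp.single j (C.dm i j)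

/-- The submodule `U·C ⊆ C`; `C/U` is the quotient by this submodule. -/
def uSub (C : PreCx) : Submodule RUV (Msub C) :=
  LinearMap.range (LinearMap.lsmul RUV (Msub C) Uv)

/-- The submodule `V·C ⊆ C`; `C/V` is the quotient by this submodule. -/
def vSub (C : PreCx) : Submodule RUV (Msub C) :=
  LinearMap.range (LinearMap.lsmul RUV (Msub C) Vv)

/-- Chains which die in the homology of `C/U`: the preimage in `C` of the boundaries of
the induced differential on `C/U`. -/
def bdryU (C : PreCx) : Submodule RUV (Msub C) := uSub C ⊔ LinearMap.range (dmap C)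

/-- Chains which die in the homology of `C/V`. -/
def bdryV (C : PreCx) : Submodule RUV (Msub C) := vSub C ⊔ LinearMap.range (dmap C)

/-- A chain `x ∈ C` is homogeneous of bidegree `(p, q)`. -/
def ChainHomog (C : PreCx) (x : Msub C) (p q : ℤ) : Prop :=
  ∀ j, IsHomog (x j) (p - (C.gr j).1) (q - (C.gr j).2)

/-- `x` is a `V`-tower class generator: its class in `H_*(C/U)` is a `V`-nontorsion cycle
whose image generates `H_*(C/U)/(V-torsion)` (equivalently, it is maximally `V`-graded
among `V`-nontorsion classes). -/
def IsVTowerGen (C : PreCx) (x : Msub C) : Prop :=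
  dmap C x ∈ uSub C ∧ (∀ k : ℕ, Vv ^ k • x ∉ bdryU C) ∧
    ∀ z : Msub C, dmap C z ∈ uSub C →
      ∃ (r : RUV) (k : ℕ), Vv ^ k • (z - r • x) ∈ bdryU C

/-- `x` is a `U`-tower class generator: its class in `H_*(C/V)` is a `U`-nontorsion cycle
whose image generates `H_*(C/V)/(U-torsion)`. -/
def IsUTowerGen (C : PreCx) (x : Msub C) : Prop :=
  dmap C x ∈ vSub C ∧ (∀ k : ℕ, Uv ^ k • x ∉ bdryV C) ∧
    ∀ z : Msub C, dmap C z ∈ vSub C →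
      ∃ (r : RUV) (k : ℕ), Uv ^ k • (z - r • x) ∈ bdryV C

/-- `C` is a chain complex over `R` whose differential has degree `(-1, -1)`. -/
def IsCplx (C : PreCx) : Prop :=
  (∀ x, dmap C (dmap C x) = 0) ∧
    ∀ i j, IsHomog (C.dm i j) ((C.gr i).1 - 1 - (C.gr j).1) ((C.gr i).2 - 1 - (C.gr j).2)

/-- A knot-like complex: a free, finitely generated, bigraded chain complex over `R`
whose differential has degree `(-1,-1)`, such that `H_*(C/U)/(V`-torsion`) ≅ 𝔽₂[V]` with
all `V`-nontorsion elements of `H_*(C/U)` in `U`-grading `0`, and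
`H_*(C/V)/(U`-torsion`) ≅ 𝔽₂[U]` with all `U`-nontorsion elements of `H_*(C/V)` in
`V`-grading `0`. -/
structure IsKnotLike (C : PreCx) : Prop where
  dsq : ∀ x, dmap C (dmap C x) = 0
  dhomog : ∀ i j, IsHomog (C.dm i j)
    ((C.gr i).1 - 1 - (C.gr j).1) ((C.gr i).2 - 1 - (C.gr j).2)
  vTowerExists : ∃ x, IsVTowerGen C x
  vTowerGr : ∀ x p q, ChainHomog C x p q → dmap C x ∈ uSub C →
    (∀ k : ℕ, Vv ^ k • x ∉ bdryU C) → p = 0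
  uTowerExists : ∃ x, IsUTowerGen C x
  uTowerGr : ∀ x p q, ChainHomog C x p q → dmap C x ∈ vSub C →
    (∀ k : ℕ, Uv ^ k • x ∉ bdryV C) → q = 0

/-- A module map `f : C₁ → C₂` is homogeneous of bidegree `(s, t)`. -/
def MapHomogShift (C₁ C₂ : PreCx) (f : Msub C₁ →ₗ[RUV] Msub C₂) (s t : ℤ) : Prop :=
  ∀ i j, IsHomog (f (Finsupp.single i 1) j)
    ((C₁.gr i).1 + s - (C₂.gr j).1) ((C₁.gr i).2 + t - (C₂.gr j).2)

/-- A local map `f : C₁ → C₂`: an absolutely `U`-graded, relatively `V`-graded,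
`R`-equivariant chain map inducing an isomorphism on `H_*(·/U)/(V-torsion)`
(equivalently, taking `V`-tower generators to `V`-tower generators). -/
structure IsLocalMap (C₁ C₂ : PreCx) (f : Msub C₁ →ₗ[RUV] Msub C₂) : Prop where
  chain : ∀ x, f (dmap C₁ x) = dmap C₂ (f x)
  graded : ∃ s : ℤ, MapHomogShift C₁ C₂ f 0 s
  towers : ∀ x, IsVTowerGen C₁ x → IsVTowerGen C₂ (f x)

/-- `C₁ ≤ C₂`: there exists a local map `C₁ → C₂`. -/
def LocalLE (C₁ C₂ : PreCx) : Prop := ∃ f, IsLocalMap C₁ C₂ f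

/-- Local equivalence of complexes: local maps in both directions. -/
def LocalEquiv (C₁ C₂ : PreCx) : Prop := LocalLE C₁ C₂ ∧ LocalLE C₂ C₁

/-- `C` is reduced: `∂ ≡ 0 mod (U, V)`. -/
def Reduced (C : PreCx) : Prop := ∀ i j, C.dm i j ∈ Ideal.span ({Uv, Vv} : Set RUV)

/-! ### Standard complexes -/

/-- The shift in bigrading from `x_k` to `x_{k+1}` in a standard complex, where the
parameter joining them is `b` (`k` is the 0-based index of the parameter, so the
parameter is a `U`-power arrow if `k` is even and a `V`-power arrow if `k` is odd). -/
def stepShift (k : ℕ) (b : ℤ) : ℤ × ℤ :=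
  if k % 2 = 0 then
    if b < 0 then (2 * (b.natAbs : ℤ) - 1, -1) else (1 - 2 * (b.natAbs : ℤ), 1)
  else
    if b < 0 then (-1, 2 * (b.natAbs : ℤ) - 1) else (1, 1 - 2 * (b.natAbs : ℤ))

/-- Bigrading of `x_i` relative to `x_0` in the standard complex with parameters `L`. -/
def grRel (L : List ℤ) (i : ℕ) : ℤ × ℤ :=
  ∑ k ∈ Finset.range i, stepShift k (L.getD k 0)

/-- The bigrading of the standard complex of parameters `L`, normalized so that
`gr_U(x_0) = 0` and `gr_V(x_n) = 0`. -/
def stdGr (L : List ℤ) (i : Fin (L.length + 1)) : ℤ × ℤ :=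
  ((grRel L (i : ℕ)).1, (grRel L (i : ℕ)).2 - (grRel L L.length).2)

/-- The differential matrix of the standard complex of parameters `L = (b_1, …, b_n)`:
for `i` odd (1-based), `∂_U x_{i-1} = U^{|b_i|} x_i` if `b_i < 0` and
`∂_U x_i = U^{b_i} x_{i-1}` if `b_i > 0`; for `i` even the same with `V` in place of `U`;
all other differentials vanish. -/
def stdDm (L : List ℤ) (i j : Fin (L.length + 1)) : RUV :=
  if (j : ℕ) = (i : ℕ) + 1 ∧ L.getD (i : ℕ) 0 < 0 then
    (if (i : ℕ) % 2 = 0 then Uv else Vv) ^ (L.getD (i : ℕ) 0).natAbs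
  else if (i : ℕ) = (j : ℕ) + 1 ∧ 0 < L.getD (j : ℕ) 0 then
    (if (j : ℕ) % 2 = 0 then Uv else Vv) ^ (L.getD (j : ℕ) 0).natAbs
  else 0

/-- The standard complex `C(b_1, …, b_n)` of a list of parameters `L = (b_1, …, b_n)`,
with generators `x_0, …, x_n`.  (For `L = []` this is the trivial complex `R`.) -/
def StdCx (L : List ℤ) : PreCx := ⟨L.length + 1, stdGr L, stdDm L⟩

/-- `L` is a valid parameter sequence for a standard complex: all entries are nonzero
and the length is even (possibly zero). -/
def IsStdSeq (L : List ℤ) : Prop := (∀ b ∈ L, b ≠ 0) ∧ Even L.length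

/-- The trivial standard complex `C(0) = R`. -/
def trivCx : PreCx := StdCx []

/-- The bigrading of the semistandard complex `C'(b_1, …, b_n)` (`n` odd), inherited from
the ambient standard complex `C(b_1, …, b_n, 1)`. -/
def semiGr (L : List ℤ) (i : Fin (L.length + 1)) : ℤ × ℤ :=
  ((grRel L (i : ℕ)).1, (grRel L (i : ℕ)).2 - (grRel L L.length).2 + 1)

/-- The semistandard complex `C'(b_1, …, b_n)` (`n` odd): the subcomplex of
`C(b_1, …, b_n, 1)` generated by `x_0, …, x_n`. -/
def SemiStdCx (L : List ℤ) : PreCx := ⟨L.length + 1, semiGr L, stdDm L⟩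

/-! ### Tensor products, duals, direct sums -/

/-- The tensor product (over `R`) of two pre-complexes, with basis `x_i ⊗ y_j` and
differential `∂(x ⊗ y) = ∂x ⊗ y + x ⊗ ∂y` (signs are irrelevant in characteristic 2). -/
def tensorCx (C₁ C₂ : PreCx) : PreCx where
  n := C₁.n * C₂.n
  gr := fun p => C₁.gr (finProdFinEquiv.symm p).1 + C₂.gr (finProdFinEquiv.symm p).2
  dm := fun p q =>
    (if (finProdFinEquiv.symm p).2 = (finProdFinEquiv.symm q).2 then
      C₁.dm (finProdFinEquiv.symm p).1 (finProdFinEquiv.symm q).1 else 0) +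
    (if (finProdFinEquiv.symm p).1 = (finProdFinEquiv.symm q).1 then
      C₂.dm (finProdFinEquiv.symm p).2 (finProdFinEquiv.symm q).2 else 0)

/-- The dual complex `C^∨ = Hom_R(C, R)`, described on the dual basis: the gradings are
negated and the differential matrix is transposed. -/
def dualCx (C : PreCx) : PreCx := ⟨C.n, fun i => -C.gr i, fun i j => C.dm j i⟩

/-- The direct sum of two pre-complexes. -/
def sumCx (C₁ C₂ : PreCx) : PreCx where
  n := C₁.n + C₂.n
  gr := fun p => Sum.elim C₁.gr C₂.gr (finSumFinEquiv.symm p)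
  dm := fun p q =>
    match finSumFinEquiv.symm p, finSumFinEquiv.symm q with
    | Sum.inl i, Sum.inl k => C₁.dm i k
    | Sum.inr j, Sum.inr l => C₂.dm j l
    | _, _ => 0

/-- A homotopy equivalence of bigraded chain complexes over `R`: chain maps `f, g`
preserving the bigrading, with `g ∘ f ≃ id` and `f ∘ g ≃ id` via `R`-equivariant
homotopies of bidegree `(1, 1)`. -/
def HomotopyEquivCx (C₁ C₂ : PreCx) : Prop :=
  ∃ (f : Msub C₁ →ₗ[RUV] Msub C₂) (g : Msub C₂ →ₗ[RUV] Msub C₁)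
    (H : Msub C₁ →ₗ[RUV] Msub C₁) (K : Msub C₂ →ₗ[RUV] Msub C₂),
    (∀ x, f (dmap C₁ x) = dmap C₂ (f x)) ∧
    (∀ y, g (dmap C₂ y) = dmap C₁ (g y)) ∧
    MapHomogShift C₁ C₂ f 0 0 ∧ MapHomogShift C₂ C₁ g 0 0 ∧
    MapHomogShift C₁ C₁ H 1 1 ∧ MapHomogShift C₂ C₂ K 1 1 ∧
    (∀ x, g (f x) - x = dmap C₁ (H x) + H (dmap C₁ x)) ∧
    (∀ y, f (g y) - y = dmap C₂ (K y) + K (dmap C₂ y))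

/-- An isomorphism of bigraded chain complexes over `R`. -/
def IsBigradedChainIso (C₁ C₂ : PreCx) (f : Msub C₁ →ₗ[RUV] Msub C₂) : Prop :=
  Function.Bijective f ∧ (∀ x, f (dmap C₁ x) = dmap C₂ (f x)) ∧ MapHomogShift C₁ C₂ f 0 0

/-! ### Short maps -/

/-- A short map `f : C(b_1, …, b_n) ⇝ C`: an absolutely `U`-graded, relatively
`V`-graded `R`-module map which is a chain map at `x_1, …, x_{n-1}` and commutes with
the `V`-part of the differential at `x_n` (for reduced `C`, the failure
`∂ f(x_n) - f(∂_V x_n)` is exactly `∂_U f(x_n) ∈ U·C`). -/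
def IsShortMap (L : List ℤ) (C : PreCx) (f : Msub (StdCx L) →ₗ[RUV] Msub C) : Prop :=
  (∃ s : ℤ, MapHomogShift (StdCx L) C f 0 s) ∧
  (∀ i : Fin (L.length + 1), 1 ≤ (i : ℕ) → (i : ℕ) + 1 ≤ L.length →
    f (dmap (StdCx L) (Finsupp.single i 1)) = dmap C (f (Finsupp.single i 1))) ∧
  dmap C (f (Finsupp.single (Fin.last L.length) 1)) -
    f (dmap (StdCx L) (Finsupp.single (Fin.last L.length) 1)) ∈ uSub C

/-- A short local map: a short map sending the `V`-tower generator `x_0` to a `V`-tower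
generator (hence inducing an isomorphism on `H_*(·/U)/(V-torsion)`). -/
def IsShortLocalMap (L : List ℤ) (C : PreCx) (f : Msub (StdCx L) →ₗ[RUV] Msub C) : Prop :=
  IsShortMap L C f ∧ IsVTowerGen C (f (Finsupp.single (0 : Fin (L.length + 1)) 1))

/-- A local map from the semistandard complex `C'(b_1, …, b_n)` to a knot-like complex:
a grading-preserving `R`-equivariant chain map under which the class of `x_0`
generates `H_*(C/U)/(V-torsion)`. -/
def IsSemiLocalMap (L : List ℤ) (C : PreCx) (f : Msub (SemiStdCx L) →ₗ[RUV] Msub C) : Prop :=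
  (∀ x, f (dmap (SemiStdCx L) x) = dmap C (f x)) ∧
  MapHomogShift (SemiStdCx L) C f 0 0 ∧
  IsVTowerGen C (f (Finsupp.single (0 : Fin (L.length + 1)) 1))

/-! ### The order `Z^!` and the numerical invariants -/

/-- The embedding of `Z^!` into `ℚ` realizing the order
`-1 <^! -2 <^! ⋯ <^! 0 <^! ⋯ <^! 2 <^! 1`: send `0 ↦ 0` and `a ↦ 1/a` otherwise. -/
def qval (a : ℤ) : ℚ := if a = 0 then 0 else 1 / (a : ℚ)

/-- The order `≤^!` on `Z^!`. -/
def bangLE (a b : ℤ) : Prop := qval a ≤ qval b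

/-- Pad a finite sequence with trailing zeros. -/
def seqPad (L : List ℤ) (i : ℕ) : ℤ := L.getD i 0

/-- The lexicographic order on finite integer sequences induced by `≤^!`, padding the
shorter sequence with trailing zeros. -/
def bangLexLE (L₁ L₂ : List ℤ) : Prop :=
  (∀ i, seqPad L₁ i = seqPad L₂ i) ∨
    ∃ k, (∀ i < k, seqPad L₁ i = seqPad L₂ i) ∧ qval (seqPad L₁ k) < qval (seqPad L₂ k)

/-- `m` is an upper bound for `S ⊆ Z^!` with respect to `≤^!`. -/
def IsBangUB (S : Set ℤ) (m : ℤ) : Prop := ∀ b ∈ S, qval b ≤ qval m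

/-- `m = sup^! S`, the least upper bound of `S ⊆ Z^!` with respect to `≤^!`. -/
def IsBangLUB (S : Set ℤ) (m : ℤ) : Prop :=
  IsBangUB S m ∧ ∀ m' : ℤ, IsBangUB S m' → qval m ≤ qval m'

/-- Candidate set for the next invariant: given the already-constructed prefix `P`,
those nonzero `b` such that some standard complex `C(P, b, rest) ≤ C`. -/
def candSet (C : PreCx) (P : List ℤ) : Set ℤ :=
  {b | b ≠ 0 ∧ ∃ rest : List ℤ, IsStdSeq (P ++ b :: rest) ∧ LocalLE (StdCx (P ++ b :: rest)) C}

/-- `a` is the sequence of numerical invariants `a_i(C)` (indexed from `0`):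
once a term vanishes all later terms vanish, and otherwise each term is
`sup^!` of the corresponding candidate set. -/
def InvSeq (C : PreCx) (a : ℕ → ℤ) : Prop :=
  ∀ k : ℕ,
    ((∃ i < k, a i = 0) → a k = 0) ∧
    ((∀ i < k, a i ≠ 0) → IsBangLUB (candSet C ((List.range k).map a)) (a k))

/-- The first `n` terms of `a`, with the (all-zero) tail deleted. -/
def truncSeq (a : ℕ → ℤ) (n : ℕ) : List ℤ :=
  ((List.range n).map a).takeWhile (fun b => b != 0)

/-! ### The homomorphisms `φ_j`, `P` and the shifts `sh_m` -/

/-- `φ_j` of a standard complex `C(a_1, …, a_n)`: the signed count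
`#{i odd : a_i = j} − #{i odd : a_i = −j}` (with 1-based odd `i`). -/
def phi (j : ℕ) (L : List ℤ) : ℤ :=
  ∑ i ∈ Finset.range L.length,
    if i % 2 = 0 then
      (if L.getD i 0 = (j : ℤ) then 1 else 0) - (if L.getD i 0 = -(j : ℤ) then 1 else 0)
    else 0

/-- The shift `sh_m` on parameter sequences: entries of absolute value `≥ m` are pushed
one further from zero; entries of absolute value `< m` are fixed. -/
def shSeq (m : ℕ) (L : List ℤ) : List ℤ :=
  L.map fun a => if (m : ℤ) ≤ a then a + 1 else if a ≤ -(m : ℤ) then a - 1 else a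

/-- `P(C) = -2 ∑_{j>0} j φ_j(C) + ∑_i sgn a_i`, computed from the parameter sequence of
the standard representative (the sum over `j` is finite since `φ_j` vanishes for
`j` larger than any `|a_i|`). -/
def Pval (L : List ℤ) : ℤ :=
  -2 * (∑ j ∈ Finset.range ((L.map Int.natAbs).sum + 1), (j : ℤ) * phi j L) +
    (L.map Int.sign).sum

end

noncomputable section

open Polynomial Matrix

/-- A trace formula for an endomorphism `h` of a differential module over a field of
characteristic two whose homology is spanned by `x`, detected by the functional `l`. -/
theorem trace_eq_of_homology_spanned {K W : Type*} [Field K] [CharP K 2] [AddCommGroup W]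
    [Module K W] [FiniteDimensional K W] (d h : W →ₗ[K] W) (l : W →ₗ[K] K) (x : W)
    (hd : ∀ v, d (d v) = 0) (hh : ∀ v, h (d v) = d (h v)) (hx : d x = 0)
    (hl : ∀ v, l (d v) = 0) (hlx : l x • x = x)
    (hspan : ∀ z, d z = 0 → z - l z • x ∈ LinearMap.range d) :
    LinearMap.trace K W h = l (h x) := by
  obtain ⟨τ, hτ⟩ := d.rangeRestrict.exists_rightInverse_of_surjective d.range_rangeRestrict
  obtain ⟨σ, hσ⟩ := LinearMap.exists_extend τ
  have hσd : ∀ v, d (σ (d v)) = d v := fun v => by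
    have h1 : σ (d v) = τ (d.rangeRestrict v) := by
      rw [← hσ]; rfl
    rw [h1]
    exact congrArg Subtype.val (LinearMap.congr_fun hτ (d.rangeRestrict v))
  set π : W →ₗ[K] W := LinearMap.id - l.smulRight x with hπ
  have hπv : ∀ v, π v = v - l v • x := fun v => by simp [hπ]
  have hdπ : ∀ v, d (π v) = d v := fun v => by simp [hπv, hx]
  have hππ : ∀ v, π (π v) = π v := fun v => by
    simp [hπv, sub_smul, mul_smul, hlx]
  have hπd : ∀ v, π (d v) = d v := fun v => by simp [hπv, hl]
  set ρ : W →ₗ[K] W := π ∘ₗ σ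
  have hρd : ∀ v, d (ρ (d v)) = d v := fun v => by simp [ρ, hdπ, hσd]
  have hπρ : ∀ v, π (ρ v) = ρ v := fun v => by simp [ρ, hππ]
  set c : W →ₗ[K] W := π - ρ ∘ₗ d
  have hdc : ∀ v, d (c v) = 0 := fun v => by simp [c, hdπ, hρd]
  have hπc : ∀ v, π (c v) = c v := fun v => by simp [c, hππ, hπρ]
  have hcr : ∀ v, d (ρ (c v)) = c v := fun v => by
    obtain ⟨w, hw⟩ := hspan _ (hdc v)
    rw [← hπv, hπc] at hw
    rw [← hw, hρd]
  have hcd : ∀ v, c (d v) = d v := fun v => by simp [c, hd, hπd]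
  set s : W →ₗ[K] W := ρ ∘ₗ c
  have hsum : d ∘ₗ s + s ∘ₗ d + l.smulRight x = LinearMap.id := by
    ext v
    have h1 : d (s v) = π v - ρ (d v) := hcr v
    have h2 : s (d v) = ρ (d v) := by simp [s, hcd]
    simp [h1, h2, hπv]
  have hhd : h ∘ₗ d = d ∘ₗ h := by ext v; exact hh v
  have h1 : LinearMap.trace K W (h ∘ₗ (d ∘ₗ s)) = LinearMap.trace K W (h ∘ₗ (s ∘ₗ d)) := by
    rw [← LinearMap.comp_assoc, hhd, LinearMap.comp_assoc, LinearMap.trace_comp_comm',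
      LinearMap.comp_assoc]
  calc LinearMap.trace K W h
      = LinearMap.trace K W (h ∘ₗ (d ∘ₗ s + s ∘ₗ d + l.smulRight x)) := by
        rw [hsum, LinearMap.comp_id]
    _ = LinearMap.trace K W (h ∘ₗ l.smulRight x) := by
        rw [LinearMap.comp_add, LinearMap.comp_add, map_add, map_add, h1, CharTwo.add_self_eq_zero,
          zero_add]
    _ = l (h x) := by
        have h2 : h ∘ₗ l.smulRight x = l.smulRight (h x) := by ext v; simp
        rw [h2, LinearMap.trace_smulRight]

/-- Either the homology is spanned by a nontrivial class, on which `h` acts by its trace, or the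
homology and the trace both vanish. -/
theorem trace_of_homology_cyclic {K W : Type*} [Field K] [CharP K 2] [AddCommGroup W]
    [Module K W] [FiniteDimensional K W] (d h : W →ₗ[K] W) (x : W) (r : K)
    (hd : ∀ v, d (d v) = 0) (hh : ∀ v, h (d v) = d (h v)) (hx : d x = 0)
    (hspan : ∀ z, d z = 0 → ∃ c : K, z - c • x ∈ LinearMap.range d)
    (hr : h x - r • x ∈ LinearMap.range d) :
    (x ∈ LinearMap.range d → LinearMap.trace K W h = 0) ∧
      (x ∉ LinearMap.range d → LinearMap.trace K W h = r) := by
  constructor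
  · intro hxd
    have := trace_eq_of_homology_spanned d h 0 0 hd hh (map_zero d) (by simp) (by simp)
      (fun z hz => by
        obtain ⟨c, hc⟩ := hspan z hz
        simpa using add_mem hc (Submodule.smul_mem _ c hxd))
    simpa using this
  · intro hxd
    obtain ⟨l₀, hl₀x, hl₀⟩ := Submodule.exists_le_ker_of_notMem hxd
    have hl₀d : ∀ w ∈ LinearMap.range d, l₀ w = 0 := fun w hw => hl₀ hw
    set l : W →ₗ[K] K := (l₀ x)⁻¹ • l₀
    have hlx : l x = 1 := by simp [l, hl₀x]
    have hl : ∀ w ∈ LinearMap.range d, l w = 0 := fun w hw => by simp [l, hl₀d w hw]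
    have := trace_eq_of_homology_spanned d h l x hd hh hx (fun v => hl _ ⟨v, rfl⟩)
      (by simp [hlx])
      (fun z hz => by
        obtain ⟨c, hc⟩ := hspan z hz
        have h1 := hl _ hc
        simp only [map_sub, map_smul, hlx, smul_eq_mul, mul_one, sub_eq_zero] at h1
        rwa [h1])
    rw [this]
    have h1 := hl _ hr
    simpa [hlx, sub_eq_zero] using h1

/-- The polynomial ring `𝔽₂[X]`, the quotient of `R` by `U` or by `V`. -/
abbrev F2X : Type := Polynomial (ZMod 2)

theorem ZMod.eq_one_of_ne_zero_two (c : ZMod 2) (hc : c ≠ 0) : c = 1 := by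
  decide +revert

/-- The chains whose class in the cokernel of `D` is killed by a power of `X`. -/
def torsionChains {n : ℕ} (D : Matrix (Fin n) (Fin n) F2X) : Submodule F2X (Fin n → F2X) where
  carrier := {v | ∃ (k : ℕ) (w : Fin n → F2X), (X : F2X) ^ k • v = w ᵥ* D}
  zero_mem' := ⟨0, 0, by simp⟩
  add_mem' := by
    rintro a b ⟨k, w, hw⟩ ⟨k', w', hw'⟩
    refine ⟨k + k', (X : F2X) ^ k' • w + (X : F2X) ^ k • w', ?_⟩
    rw [add_vecMul, smul_vecMul, smul_vecMul, ← hw, ← hw', smul_add, smul_smul, smul_smul,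
      ← pow_add, ← pow_add, add_comm k' k]
  smul_mem' := by
    rintro c a ⟨k, w, hw⟩
    exact ⟨k, c • w, by rw [smul_vecMul, ← hw, smul_comm]⟩

theorem vecMul_mem_torsionChains {n : ℕ} (D : Matrix (Fin n) (Fin n) F2X) (w : Fin n → F2X) :
    w ᵥ* D ∈ torsionChains D := ⟨0, w, by simp⟩

theorem mem_torsionChains_of_pow_smul_mem {n : ℕ} {D : Matrix (Fin n) (Fin n) F2X}
    {v : Fin n → F2X} {k : ℕ} (hv : (X : F2X) ^ k • v ∈ torsionChains D) :
    v ∈ torsionChains D := by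
  obtain ⟨l, w, hw⟩ := hv
  exact ⟨l + k, w, by rw [pow_add, mul_smul, hw]⟩

theorem torsionChains_map {m n : ℕ} {D : Matrix (Fin m) (Fin m) F2X}
    {E : Matrix (Fin n) (Fin n) F2X} {M : Matrix (Fin m) (Fin n) F2X} (hM : D * M = M * E)
    {v : Fin m → F2X} (hv : v ∈ torsionChains D) : v ᵥ* M ∈ torsionChains E := by
  obtain ⟨k, w, hw⟩ := hv
  exact ⟨k, w ᵥ* M, by rw [← smul_vecMul, hw, vecMul_vecMul, vecMul_vecMul, hM]⟩

/-- `x` is a cycle generating the homology of `D` modulo `X`-torsion, and is not torsion. -/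
structure IsTowerGen {n : ℕ} (D : Matrix (Fin n) (Fin n) F2X) (x : Fin n → F2X) : Prop where
  cycle : x ᵥ* D = 0
  notMem : x ∉ torsionChains D
  span : ∀ z, z ᵥ* D = 0 → ∃ r : F2X, z - r • x ∈ torsionChains D

/-- Base change to the fraction field gives the trace dichotomy over `𝔽₂[X]`. -/
theorem trace_of_isTowerGen_of_isFractionRing (K : Type*) [Field K] [Algebra F2X K]
    [IsFractionRing F2X K] {n : ℕ} {D H : Matrix (Fin n) (Fin n) F2X} (hD : D * D = 0)
    (hH : D * H = H * D) {x : Fin n → F2X} (hx : IsTowerGen D x) {r : F2X}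
    (hr : x ᵥ* H - r • x ∈ torsionChains D) :
    H.trace = r ∨ (H.trace = 0 ∧ ∃ p : F2X, p ≠ 0 ∧ p • x ∈ torsionChains D) := by
  let ι : F2X →+* K := algebraMap F2X K
  have hι : Function.Injective ι := IsFractionRing.injective F2X K
  have : CharP K 2 := charP_of_injective_ringHom hι 2
  let d : (Fin n → K) →ₗ[K] (Fin n → K) := (D.map ι).vecMulLinear
  let h : (Fin n → K) →ₗ[K] (Fin n → K) := (H.map ι).vecMulLinear
  have hdι : ∀ v : Fin n → F2X, d (ι ∘ v) = ι ∘ (v ᵥ* D) := fun v => by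
    ext j; exact (RingHom.map_vecMul ι D v j).symm
  have hhι : ∀ v : Fin n → F2X, h (ι ∘ v) = ι ∘ (v ᵥ* H) := fun v => by
    ext j; exact (RingHom.map_vecMul ι H v j).symm
  have hsub : ∀ v w : Fin n → F2X, ι ∘ (v - w) = ι ∘ v - ι ∘ w := fun v w => by ext; simp
  have hsmul : ∀ (c : F2X) (v : Fin n → F2X), ι ∘ (c • v) = ι c • (ι ∘ v) := fun c v => by
    ext; simp
  have hclear : ∀ v : Fin n → K, ∃ (c : F2X) (w : Fin n → F2X), c ≠ 0 ∧ ι c • v = ι ∘ w := by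
    intro v
    obtain ⟨b, hb⟩ := IsLocalization.exist_integer_multiples_of_finite (nonZeroDivisors F2X) v
    choose w hw using hb
    refine ⟨b, w, nonZeroDivisors.coe_ne_zero b, ?_⟩
    ext j
    simp only [Pi.smul_apply, smul_eq_mul, Function.comp_apply, ι]
    rw [hw, Algebra.smul_def]
  have htors : ∀ v ∈ torsionChains D, ι ∘ v ∈ LinearMap.range d := by
    rintro v ⟨k, w, hw⟩
    refine ⟨(ι (X ^ k))⁻¹ • (ι ∘ w), ?_⟩
    have h0 : ι (X ^ k) ≠ 0 := by
      rw [map_ne_zero_iff ι hι]; exact pow_ne_zero _ Polynomial.X_ne_zero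
    rw [map_smul, hdι, ← hw, hsmul, smul_smul, inv_mul_cancel₀ h0, one_smul]
  have htr : LinearMap.trace K _ h = ι H.trace := by
    have : h = Matrix.toLin' (H.map ι)ᵀ := by
      ext v j; simp [h]
    rw [this, Matrix.trace_toLin'_eq, Matrix.trace_transpose]
    exact (AddMonoidHom.map_trace ι.toAddMonoidHom H).symm
  have main := trace_of_homology_cyclic d h (ι ∘ x) (ι r)
    (fun v => by
      simp only [d, Matrix.vecMulLinear_apply, Matrix.vecMul_vecMul]
      rw [← Matrix.map_mul, hD]; simp)
    (fun v => by
      simp only [d, h, Matrix.vecMulLinear_apply, Matrix.vecMul_vecMul]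
      rw [← Matrix.map_mul, hH, Matrix.map_mul])
    (by rw [hdι, hx.cycle]; ext; simp)
    (fun z hz => by
      obtain ⟨c, w, hc, hw⟩ := hclear z
      have hwD : w ᵥ* D = 0 := by
        have h1 : ι ∘ (w ᵥ* D) = 0 := by rw [← hdι, ← hw, map_smul, hz, smul_zero]
        ext1 j
        exact hι (by simpa using congrFun h1 j)
      obtain ⟨s, hs⟩ := hx.span w hwD
      have h2 := htors _ hs
      rw [hsub, hsmul, ← hw] at h2
      have hc0 : ι c ≠ 0 := by rwa [map_ne_zero_iff ι hι]
      refine ⟨(ι c)⁻¹ * ι s, ?_⟩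
      have h3 := Submodule.smul_mem _ (ι c)⁻¹ h2
      rwa [smul_sub, smul_smul, inv_mul_cancel₀ hc0, one_smul, smul_smul] at h3)
    (by
      have h2 := htors _ hr
      rwa [hsub, hsmul, ← hhι] at h2)
  by_cases hxd : ι ∘ x ∈ LinearMap.range d
  · right
    refine ⟨hι (by rw [← htr, main.1 hxd, map_zero]), ?_⟩
    obtain ⟨y, hy⟩ := hxd
    obtain ⟨c, w, hc, hw⟩ := hclear y
    refine ⟨c, hc, ?_⟩
    have h1 : c • x = w ᵥ* D := by
      have h2 : ι ∘ (c • x) = ι ∘ (w ᵥ* D) := by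
        rw [hsmul, ← hdι, ← hw, map_smul, hy]
      ext1 j
      exact hι (congrFun h2 j)
    rw [h1]
    exact vecMul_mem_torsionChains D w
  · left
    exact hι (by rw [← htr, main.2 hxd])

/-- The trace of an endomorphism of a complex with a tower generator `x` is its eigenvalue on
`x`, unless `x` is torsion over `𝔽₂[X]`. -/
theorem trace_of_isTowerGen {n : ℕ} {D H : Matrix (Fin n) (Fin n) F2X} (hD : D * D = 0)
    (hH : D * H = H * D) {x : Fin n → F2X} (hx : IsTowerGen D x) {r : F2X}
    (hr : x ᵥ* H - r • x ∈ torsionChains D) :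
    H.trace = r ∨ (H.trace = 0 ∧ ∃ p : F2X, p ≠ 0 ∧ p • x ∈ torsionChains D) :=
  trace_of_isTowerGen_of_isFractionRing (FractionRing F2X) hD hH hx hr

/-- The entries of `M` are monomials, homogeneous of bidegree `(s, t)` for the bigradings
`a, a'` of the rows and columns, where `X` has bidegree `(0, -2)`. -/
def MatHomog {m n : ℕ} (a : Fin m → ℤ × ℤ) (a' : Fin n → ℤ × ℤ)
    (M : Matrix (Fin m) (Fin n) F2X) (s t : ℤ) : Prop :=
  ∀ i j, M i j = 0 ∨ ∃ b : ℕ, M i j = X ^ b ∧ (a i).1 + s = (a' j).1 ∧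
    (a i).2 + t = (a' j).2 - 2 * b

/-- The part of the polynomial `f` lying in bidegree `s` when `1` has bidegree `a`. -/
def polyComp (a s : ℤ × ℤ) (f : F2X) : F2X :=
  ∑ k ∈ f.support.filter (fun k : ℕ => (a.1, a.2 - 2 * (k : ℤ)) = s), monomial k (f.coeff k)

theorem coeff_polyComp (a s : ℤ × ℤ) (f : F2X) (k : ℕ) :
    (polyComp a s f).coeff k = if (a.1, a.2 - 2 * (k : ℤ)) = s then f.coeff k else 0 := by
  simp only [polyComp, finsetSum_coeff, coeff_monomial, Finset.sum_ite_eq', Finset.mem_filter,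
    mem_support_iff]
  split_ifs <;> simp_all

/-- The component of a chain in bidegree `s`. -/
def chainComp {n : ℕ} (a : Fin n → ℤ × ℤ) (s : ℤ × ℤ) (v : Fin n → F2X) : Fin n → F2X :=
  fun j => polyComp (a j) s (v j)

theorem polyComp_sum {ι : Type*} (S : Finset ι) (a s : ℤ × ℤ) (f : ι → F2X) :
    polyComp a s (∑ i ∈ S, f i) = ∑ i ∈ S, polyComp a s (f i) := by
  ext k
  simp only [coeff_polyComp, finsetSum_coeff]
  split_ifs <;> simp

theorem chainComp_sub {n : ℕ} (a : Fin n → ℤ × ℤ) (s : ℤ × ℤ) (v w : Fin n → F2X) :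
    chainComp a s (v - w) = chainComp a s v - chainComp a s w := by
  ext j k
  simp only [chainComp, Pi.sub_apply, coeff_sub, coeff_polyComp]
  split_ifs <;> simp

theorem chainComp_pow_smul {n : ℕ} (a : Fin n → ℤ × ℤ) (s : ℤ × ℤ) (b : ℕ) (v : Fin n → F2X) :
    chainComp a s ((X : F2X) ^ b • v) = (X : F2X) ^ b • chainComp a (s.1, s.2 + 2 * b) v := by
  ext j k
  simp only [chainComp, Pi.smul_apply, smul_eq_mul, coeff_X_pow_mul', coeff_polyComp, Prod.ext_iff]
  split_ifs <;> first | rfl | (exfalso; omega)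

theorem chainComp_vecMul {m n : ℕ} {a : Fin m → ℤ × ℤ} {a' : Fin n → ℤ × ℤ}
    {M : Matrix (Fin m) (Fin n) F2X} {s t : ℤ} (hM : MatHomog a a' M s t) (p : ℤ × ℤ)
    (v : Fin m → F2X) :
    chainComp a' (p.1 + s, p.2 + t) (v ᵥ* M) = chainComp a p v ᵥ* M := by
  funext j
  simp only [chainComp, vecMul, dotProduct, polyComp_sum]
  refine Finset.sum_congr rfl fun i _ => ?_
  rcases hM i j with h | ⟨b, h, h1, h2⟩
  · rw [h]; simp [polyComp]
  · rw [h]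
    ext k
    simp only [coeff_mul_X_pow', coeff_polyComp, Prod.ext_iff]
    split_ifs <;> first | rfl | (exfalso; omega)

theorem chainComp_eq_zero_of_lt {n : ℕ} {a : Fin n → ℤ × ℤ} {s : ℤ × ℤ}
    (hs : ∀ j, (a j).2 < s.2) (v : Fin n → F2X) : chainComp a s v = 0 := by
  ext j k
  simp only [chainComp, coeff_polyComp, Pi.zero_apply, coeff_zero, Prod.ext_iff]
  have := hs j
  rw [if_neg]
  rintro ⟨-, h⟩
  omega

/-- Every entry of a homogeneous component is zero or a monomial of the right degree. -/
theorem chainComp_apply {n : ℕ} (a : Fin n → ℤ × ℤ) (s : ℤ × ℤ) (v : Fin n → F2X) (j : Fin n) :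
    chainComp a s v j = 0 ∨
      ∃ k : ℕ, chainComp a s v j = X ^ k ∧ (a j).1 = s.1 ∧ (a j).2 - 2 * k = s.2 := by
  by_cases h : chainComp a s v j = 0
  · exact Or.inl h
  right
  obtain ⟨k, hk⟩ : ∃ k, (chainComp a s v j).coeff k ≠ 0 := by
    by_contra! hc
    exact h (Polynomial.ext (by simpa using hc))
  have hk' := hk
  simp only [chainComp, coeff_polyComp] at hk
  have hks : ((a j).1, (a j).2 - 2 * (k : ℤ)) = s := by
    by_contra hc
    exact hk (if_neg hc)
  refine ⟨k, ?_, by rw [← hks], by rw [← hks]⟩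
  ext l
  rw [coeff_X_pow]
  split_ifs with hl
  · subst hl
    exact (ZMod.eq_one_of_ne_zero_two _ hk')
  · simp only [chainComp, coeff_polyComp]
    rw [if_neg]
    rw [← hks]
    simp only [Prod.ext_iff, true_and]
    omega

/-- A submodule containing all homogeneous components of a chain contains the chain. -/
theorem mem_of_chainComp_mem {n : ℕ} (a : Fin n → ℤ × ℤ) (T : Submodule F2X (Fin n → F2X))
    (v : Fin n → F2X) (h : ∀ s, chainComp a s v ∈ T) : v ∈ T := by
  let S : Finset (ℤ × ℤ) := Finset.univ.biUnion fun j : Fin n =>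
    (v j).support.image fun k : ℕ => ((a j).1, (a j).2 - 2 * (k : ℤ))
  have hv : v = ∑ s ∈ S, chainComp a s v := by
    ext j k
    simp only [Finset.sum_apply, finsetSum_coeff, chainComp, coeff_polyComp, Finset.sum_ite_eq]
    split_ifs with hS
    · rfl
    · by_contra hc
      exact hS (Finset.mem_biUnion.2 ⟨j, Finset.mem_univ j,
        Finset.mem_image.2 ⟨k, mem_support_iff.2 hc, rfl⟩⟩)
  rw [hv]
  exact sum_mem fun s _ => h s

theorem chainComp_mem_torsionChains {n : ℕ} {a : Fin n → ℤ × ℤ}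
    {D : Matrix (Fin n) (Fin n) F2X} {s t : ℤ} (hD : MatHomog a a D s t) {v : Fin n → F2X}
    (hv : v ∈ torsionChains D) (p : ℤ × ℤ) : chainComp a p v ∈ torsionChains D := by
  obtain ⟨k, w, hw⟩ := hv
  refine ⟨k, chainComp a (p.1 - s, p.2 - 2 * k - t) w, ?_⟩
  rw [← chainComp_vecMul hD, ← hw, chainComp_pow_smul]
  simp

/-- In a graded complex, the cokernel of the differential has no torsion besides `X`-torsion. -/
theorem mem_torsionChains_of_smul_mem {n : ℕ} {a : Fin n → ℤ × ℤ}
    {D : Matrix (Fin n) (Fin n) F2X} {s t : ℤ} (hD : MatHomog a a D s t) {v : Fin n → F2X}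
    {p : F2X} (hp : p ≠ 0) (hv : p • v ∈ torsionChains D) : v ∈ torsionChains D := by
  obtain ⟨q, hpq, hq⟩ := exists_eq_pow_rootMultiplicity_mul_and_not_dvd p hp 0
  rw [C_0, sub_zero] at hpq hq
  rw [hpq, mul_smul] at hv
  have hqv := mem_torsionChains_of_pow_smul_mem hv
  have hq1 : q.coeff 0 = 1 := ZMod.eq_one_of_ne_zero_two _ fun h => hq (X_dvd_iff.2 h)
  obtain ⟨m, hm⟩ : (X : F2X) ∣ 1 - q := X_dvd_iff.2 (by simp [hq1])
  have key : ∀ N : ℕ, v - (X : F2X) ^ N • (m ^ N • v) ∈ torsionChains D := by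
    intro N
    obtain ⟨e, he⟩ : q ∣ 1 - (X * m) ^ N := by
      rw [← hm]
      have := sub_dvd_pow_sub_pow (1 : F2X) (1 - q) N
      simpa using this
    have h2 : v - (X : F2X) ^ N • (m ^ N • v) = e • (q • v) := by
      rw [smul_smul, smul_smul, ← mul_pow, mul_comm e q, ← he, sub_smul, one_smul]
    rw [h2]
    exact Submodule.smul_mem _ _ hqv
  refine mem_of_chainComp_mem a _ v fun p => ?_
  obtain ⟨B, hB⟩ : ∃ B : ℤ, ∀ j, (a j).2 ≤ B := by
    obtain ⟨B, hB⟩ := (Set.finite_range fun j => (a j).2).bddAbove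
    exact ⟨B, fun j => hB ⟨j, rfl⟩⟩
  have h3 := chainComp_mem_torsionChains hD (key ((B - p.2).toNat + 1)) p
  rw [chainComp_sub, chainComp_pow_smul] at h3
  have h4 : ∀ j, (a j).2 < p.2 + 2 * (((B - p.2).toNat + 1 : ℕ) : ℤ) := fun j => by
    have := hB j
    omega
  rwa [chainComp_eq_zero_of_lt (s := (_, _)) h4, smul_zero, sub_zero] at h3

/-- A homogeneous self-map preserving tower generators has degree zero and trace one. -/
theorem trace_eq_one_of_isTowerGen {n : ℕ} {a : Fin n → ℤ × ℤ}
    {D H : Matrix (Fin n) (Fin n) F2X} (hD : D * D = 0) (hH : D * H = H * D) {s t : ℤ}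
    (hDa : MatHomog a a D s t) {σ : ℤ}
    (hHd : ∀ i, H i i = 0 ∨ ∃ b : ℕ, H i i = X ^ b ∧ σ = -(2 * (b : ℤ)))
    {x : Fin n → F2X} (hx : IsTowerGen D x) (hHx : IsTowerGen D (x ᵥ* H)) :
    σ = 0 ∧ H.trace = 1 := by
  obtain ⟨r, hr⟩ := hx.span _ hHx.cycle
  have hnt : ∀ p : F2X, p • x ∈ torsionChains D → p = 0 := fun p hp => by
    by_contra hp0
    exact hx.notMem (mem_torsionChains_of_smul_mem hDa hp0 hp)
  have htr : H.trace = r := by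
    rcases trace_of_isTowerGen hD hH hx hr with h | ⟨-, p, hp, hpx⟩
    · exact h
    · exact absurd (hnt p hpx) hp
  have hr0 : r ≠ 0 := by
    rintro rfl
    exact hHx.notMem (by simpa using hr)
  obtain ⟨b, hb⟩ : ∃ b : ℕ, σ = -(2 * (b : ℤ)) := by
    by_contra! hc
    refine hr0 (htr ▸ Finset.sum_eq_zero fun i _ => ?_)
    rcases hHd i with h | ⟨b, -, hb⟩
    · exact h
    · exact absurd hb (hc b)
  have hdvd : (X : F2X) ^ b ∣ r := by
    rw [← htr]
    refine Finset.dvd_sum fun i _ => ?_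
    rcases hHd i with h | ⟨b', h, hb'⟩
    · simp [h]
    · obtain rfl : b = b' := by omega
      simp [h]
  obtain ⟨r', hr'⟩ := hHx.span _ hx.cycle
  have h1 : (1 - r' * r) • x ∈ torsionChains D := by
    have := add_mem hr' (Submodule.smul_mem _ r' hr)
    rw [smul_sub, smul_smul, sub_add_sub_cancel] at this
    rwa [sub_smul, one_smul]
  have hu : IsUnit r := IsUnit.of_mul_eq_one_right r' (sub_eq_zero.1 (hnt _ h1)).symm
  have hb0 : b = 0 := by
    by_contra hb0
    have hX : IsUnit (X : F2X) := isUnit_of_dvd_unit ((dvd_pow_self X hb0).trans hdvd) hu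
    exact Polynomial.not_isUnit_X hX
  refine ⟨by omega, ?_⟩
  rw [htr]
  obtain ⟨c, hc, rfl⟩ := Polynomial.isUnit_iff.1 hu
  rw [ZMod.eq_one_of_ne_zero_two c hc.ne_zero, C_1]

/-- A self-map of trace one acts as the identity on homology modulo torsion. -/
theorem vecMul_sub_mem_torsionChains {n : ℕ} {D H : Matrix (Fin n) (Fin n) F2X} (hD : D * D = 0)
    (hH : D * H = H * D) (htr : H.trace = 1) {x : Fin n → F2X} (hx : IsTowerGen D x)
    {z : Fin n → F2X} (hz : z ᵥ* D = 0) : z ᵥ* H - z ∈ torsionChains D := by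
  obtain ⟨r, hr⟩ := hx.span (x ᵥ* H)
    (by rw [vecMul_vecMul, ← hH, ← vecMul_vecMul, hx.cycle, zero_vecMul])
  obtain rfl : r = 1 := by
    rcases trace_of_isTowerGen hD hH hx hr with h | ⟨h, -⟩
    · rw [← h, htr]
    · exact absurd (h.symm.trans htr) zero_ne_one
  rw [one_smul] at hr
  obtain ⟨c, hc⟩ := hx.span z hz
  have h1 := add_mem (sub_mem (torsionChains_map hH hc) hc) (Submodule.smul_mem _ c hr)
  convert h1 using 1
  rw [sub_vecMul, smul_vecMul, smul_sub]
  abel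

/-- Maps in both directions which are mutually inverse modulo torsion preserve tower
generators. -/
theorem IsTowerGen.map {m n : ℕ} {D : Matrix (Fin m) (Fin m) F2X}
    {E : Matrix (Fin n) (Fin n) F2X} {M : Matrix (Fin m) (Fin n) F2X}
    {N : Matrix (Fin n) (Fin m) F2X} (hM : D * M = M * E) (hN : E * N = N * D)
    (hMN : ∀ z, z ᵥ* D = 0 → z ᵥ* (M * N) - z ∈ torsionChains D)
    (hNM : ∀ z, z ᵥ* E = 0 → z ᵥ* (N * M) - z ∈ torsionChains E)
    {x : Fin m → F2X} (hx : IsTowerGen D x) : IsTowerGen E (x ᵥ* M) where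
  cycle := by rw [vecMul_vecMul, ← hM, ← vecMul_vecMul, hx.cycle, zero_vecMul]
  notMem h := by
    have h1 := torsionChains_map hN h
    rw [vecMul_vecMul] at h1
    exact hx.notMem (by simpa using sub_mem h1 (hMN x hx.cycle))
  span z hz := by
    obtain ⟨r, hr⟩ := hx.span (z ᵥ* N)
      (by rw [vecMul_vecMul, ← hN, ← vecMul_vecMul, hz, zero_vecMul])
    refine ⟨r, ?_⟩
    have h1 := sub_mem (torsionChains_map hM hr) (hNM z hz)
    convert h1 using 1
    rw [sub_vecMul, smul_vecMul, vecMul_vecMul]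
    abel

theorem Uv_mul_Vv : Uv * Vv = 0 :=
  Ideal.Quotient.eq_zero_iff_mem.2 (Ideal.subset_span rfl)

theorem IsHomog.add {r r' : RUV} {p q : ℤ} (h : IsHomog r p q) (h' : IsHomog r' p q) :
    IsHomog (r + r') p q := by
  have key : r = 0 ∨ r' = 0 ∨ r = r' := by
    rcases h with h | ⟨a, rfl, ha, ha'⟩ | ⟨a, rfl, ha, ha'⟩
    · exact Or.inl h
    all_goals
      rcases h' with h' | ⟨b, rfl, hb, hb'⟩ | ⟨b, rfl, hb, hb'⟩
      · exact Or.inr (Or.inl h')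
      all_goals
        obtain rfl : a = b := by omega
        right; right
        first
          | rfl
          | have h0 : a = 0 := by omega
            rw [h0, pow_zero, pow_zero]
  rcases key with rfl | rfl | rfl
  · rwa [zero_add]
  · rwa [add_zero]
  · exact Or.inl (ZModModule.add_self r)

theorem IsHomog.sum {ι : Type*} (S : Finset ι) {r : ι → RUV} {p q : ℤ}
    (h : ∀ i ∈ S, IsHomog (r i) p q) : IsHomog (∑ i ∈ S, r i) p q :=
  Finset.sum_induction r (IsHomog · p q) (fun _ _ => IsHomog.add) (Or.inl rfl) h

theorem Uv_pow_mul_Vv_pow (a b : ℕ) : Uv ^ (a + 1) * Vv ^ (b + 1) = 0 := by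
  calc Uv ^ (a + 1) * Vv ^ (b + 1) = Uv * Vv * (Uv ^ a * Vv ^ b) := by ring
    _ = 0 := by rw [Uv_mul_Vv, zero_mul]

theorem IsHomog.mul {r r' : RUV} {p q p' q' : ℤ} (h : IsHomog r p q) (h' : IsHomog r' p' q') :
    IsHomog (r * r') (p + p') (q + q') := by
  rcases h with rfl | ⟨a, rfl, rfl, rfl⟩ | ⟨a, rfl, rfl, rfl⟩
  · exact Or.inl (zero_mul _)
  all_goals rcases h' with rfl | ⟨b, rfl, rfl, rfl⟩ | ⟨b, rfl, rfl, rfl⟩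
  · exact Or.inl (mul_zero _)
  · exact Or.inr (Or.inl ⟨a + b, (pow_add _ _ _).symm, by push_cast; ring, by simp⟩)
  · rcases a with _ | a
    · exact Or.inr (Or.inr ⟨b, by simp, by simp, by simp⟩)
    rcases b with _ | b
    · exact Or.inr (Or.inl ⟨a + 1, by simp, by simp, by simp⟩)
    exact Or.inl (Uv_pow_mul_Vv_pow a b)
  · exact Or.inl (mul_zero _)
  · rcases a with _ | a
    · exact Or.inr (Or.inl ⟨b, by simp, by simp, by simp⟩)
    rcases b with _ | b
    · exact Or.inr (Or.inr ⟨a + 1, by simp, by simp, by simp⟩)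
    exact Or.inl (by rw [mul_comm, Uv_pow_mul_Vv_pow])
  · exact Or.inr (Or.inr ⟨a + b, (pow_add _ _ _).symm, by simp, by push_cast; ring⟩)

theorem linearMap_finsupp_apply {m n : ℕ} (F : (Fin m →₀ RUV) →ₗ[RUV] (Fin n →₀ RUV))
    (x : Fin m →₀ RUV) (j : Fin n) : F x j = ∑ i, x i * F (Finsupp.single i 1) j := by
  conv_lhs => rw [← Finsupp.univ_sum_single x, map_sum, Finsupp.finsetSum_apply]
  refine Finset.sum_congr rfl fun i _ => ?_
  rw [← mul_one (x i), ← smul_eq_mul, ← Finsupp.smul_single, map_smul]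
  simp

theorem MapHomogShift.chainHomog {C₁ C₂ : PreCx} {f : Msub C₁ →ₗ[RUV] Msub C₂} {s t : ℤ}
    (hf : MapHomogShift C₁ C₂ f s t) {x : Msub C₁} {p q : ℤ} (hx : ChainHomog C₁ x p q) :
    ChainHomog C₂ (f x) (p + s) (q + t) := fun j => by
  rw [linearMap_finsupp_apply]
  refine IsHomog.sum _ fun i _ => ?_
  convert (hx i).mul (hf i j) using 1 <;> ring

theorem MapHomogShift.comp {C₁ C₂ C₃ : PreCx} {f : Msub C₁ →ₗ[RUV] Msub C₂}
    {g : Msub C₂ →ₗ[RUV] Msub C₃} {s t s' t' : ℤ} (hf : MapHomogShift C₁ C₂ f s t)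
    (hg : MapHomogShift C₂ C₃ g s' t') : MapHomogShift C₁ C₃ (g ∘ₗ f) (s + s') (t + t') :=
  fun i j => by
    have := hg.chainHomog (hf i) j
    rwa [add_assoc, add_assoc] at this

theorem dmap_single (C : PreCx) (i j : Fin C.n) : dmap C (Finsupp.single i 1) j = C.dm i j := by
  simp [dmap, Finsupp.finsetSum_apply, Finsupp.single_apply]

theorem IsKnotLike.dmap_homog {C : PreCx} (hC : IsKnotLike C) :
    MapHomogShift C C (dmap C) (-1) (-1) := fun i j => by
  rw [dmap_single]
  exact hC.dhomog i j

/-- The ring homomorphism `φ : R → 𝔽₂[X]` is the quotient by `A`, sending `B` to `X`. -/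
structure IsSpecialization (φ : RUV →+* F2X) (A B : RUV) : Prop where
  map_left : φ A = 0
  map_right : φ B = X
  decomp : ∀ r, ∃ t, r = aeval B (φ r) + A * t

theorem isSpecialization_of_generators {φ : RUV →+* F2X} {A B : RUV} (hA : φ A = 0)
    (hB : φ B = X) (h : ∀ i, Ideal.Quotient.mk IUV (MvPolynomial.X i) = A ∨
      Ideal.Quotient.mk IUV (MvPolynomial.X i) = B) : IsSpecialization φ A B where
  map_left := hA
  map_right := hB
  decomp r := by
    obtain ⟨p, rfl⟩ := Ideal.Quotient.mk_surjective r
    induction p using MvPolynomial.induction_on with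
    | C a =>
      refine ⟨0, ?_⟩
      have : (Ideal.Quotient.mk IUV).comp MvPolynomial.C =
          (aeval B : F2X →ₐ[ZMod 2] RUV).toRingHom.comp
            (φ.comp ((Ideal.Quotient.mk IUV).comp MvPolynomial.C)) := Subsingleton.elim _ _
      simpa using RingHom.congr_fun this a
    | add p q hp hq =>
      obtain ⟨t, ht⟩ := hp
      obtain ⟨u, hu⟩ := hq
      refine ⟨t + u, ?_⟩
      rw [map_add, map_add, map_add]
      linear_combination ht + hu
    | mul_X p i hp =>
      obtain ⟨t, ht⟩ := hp
      rcases h i with hi | hi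
      · refine ⟨Ideal.Quotient.mk IUV p, ?_⟩
        rw [map_mul, map_mul, map_mul, hi, hA]
        simp [mul_comm]
      · refine ⟨t * B, ?_⟩
        rw [map_mul, map_mul, map_mul, hi, hB, aeval_X]
        linear_combination B * ht

/-- The homomorphism `R → 𝔽₂[X]` sending `U` to `u` and `V` to `v`. -/
def evalUV (u v : F2X) (h : u * v = 0) : RUV →+* F2X :=
  Ideal.Quotient.lift IUV (MvPolynomial.aeval ![u, v]).toRingHom fun a ha => by
    obtain ⟨c, rfl⟩ := Ideal.mem_span_singleton.1 ha
    simp [h]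

theorem evalUV_Uv (u v : F2X) (h : u * v = 0) : evalUV u v h Uv = u := by
  simp [evalUV, Uv]

theorem evalUV_Vv (u v : F2X) (h : u * v = 0) : evalUV u v h Vv = v := by
  simp [evalUV, Vv]

/-- The quotient map `R → R/U ≅ 𝔽₂[V]`. -/
def modU : RUV →+* F2X := evalUV 0 X (zero_mul X)

/-- The quotient map `R → R/V ≅ 𝔽₂[U]`. -/
def modV : RUV →+* F2X := evalUV X 0 (mul_zero X)

theorem isSpecialization_modU : IsSpecialization modU Uv Vv :=
  isSpecialization_of_generators (evalUV_Uv _ _ _) (evalUV_Vv _ _ _) fun i => by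
    fin_cases i
    · exact Or.inl rfl
    · exact Or.inr rfl

theorem isSpecialization_modV : IsSpecialization modV Vv Uv :=
  isSpecialization_of_generators (evalUV_Vv _ _ _) (evalUV_Uv _ _ _) fun i => by
    fin_cases i
    · exact Or.inr rfl
    · exact Or.inl rfl

theorem IsHomog.modU {r : RUV} {p q : ℤ} (h : IsHomog r p q) :
    modU r = 0 ∨ ∃ b : ℕ, modU r = X ^ b ∧ p = 0 ∧ q = -(2 * (b : ℤ)) := by
  rcases h with rfl | ⟨a, rfl, rfl, rfl⟩ | ⟨b, rfl, rfl, rfl⟩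
  · exact Or.inl (map_zero _)
  · rcases a with _ | a
    · exact Or.inr ⟨0, by simp⟩
    · exact Or.inl (by rw [map_pow, isSpecialization_modU.map_left, zero_pow a.succ_ne_zero])
  · exact Or.inr ⟨b, by rw [map_pow, isSpecialization_modU.map_right], rfl, rfl⟩

theorem IsHomog.modV {r : RUV} {p q : ℤ} (h : IsHomog r p q) :
    modV r = 0 ∨ ∃ b : ℕ, modV r = X ^ b ∧ q = 0 ∧ p = -(2 * (b : ℤ)) := by
  rcases h with rfl | ⟨a, rfl, rfl, rfl⟩ | ⟨b, rfl, rfl, rfl⟩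
  · exact Or.inl (map_zero _)
  · exact Or.inr ⟨a, by rw [map_pow, isSpecialization_modV.map_right], rfl, rfl⟩
  · rcases b with _ | b
    · exact Or.inr ⟨0, by simp⟩
    · exact Or.inl (by rw [map_pow, isSpecialization_modV.map_left, zero_pow b.succ_ne_zero])

/-- The image of a chain under a ring homomorphism. -/
def specChain (φ : RUV →+* F2X) {n : ℕ} (x : Fin n →₀ RUV) : Fin n → F2X := fun j => φ (x j)

/-- The image under a ring homomorphism of the matrix of a linear map, acting on row vectors. -/
def specMatrix (φ : RUV →+* F2X) {m n : ℕ} (F : (Fin m →₀ RUV) →ₗ[RUV] (Fin n →₀ RUV)) :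
    Matrix (Fin m) (Fin n) F2X := fun i j => φ (F (Finsupp.single i 1) j)

theorem specChain_map (φ : RUV →+* F2X) {m n : ℕ} (F : (Fin m →₀ RUV) →ₗ[RUV] (Fin n →₀ RUV))
    (x : Fin m →₀ RUV) : specChain φ (F x) = specChain φ x ᵥ* specMatrix φ F := by
  ext1 j
  simp only [specChain, linearMap_finsupp_apply F x j, map_sum, map_mul]
  rfl

theorem specMatrix_comp (φ : RUV →+* F2X) {l m n : ℕ}
    (F : (Fin l →₀ RUV) →ₗ[RUV] (Fin m →₀ RUV)) (G : (Fin m →₀ RUV) →ₗ[RUV] (Fin n →₀ RUV)) :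
    specMatrix φ (G ∘ₗ F) = specMatrix φ F * specMatrix φ G := by
  ext1 i j
  exact congrFun (specChain_map φ G (F (Finsupp.single i 1))) j

theorem specMatrix_dmap_sq (φ : RUV →+* F2X) {C : PreCx} (hC : IsKnotLike C) :
    specMatrix φ (dmap C) * specMatrix φ (dmap C) = 0 := by
  rw [← specMatrix_comp]
  ext1 i j
  simp [specMatrix, hC.dsq]

theorem specMatrix_commute (φ : RUV →+* F2X) {C₁ C₂ : PreCx} {f : Msub C₁ →ₗ[RUV] Msub C₂}
    (hf : ∀ x, f (dmap C₁ x) = dmap C₂ (f x)) :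
    specMatrix φ (dmap C₁) * specMatrix φ f = specMatrix φ f * specMatrix φ (dmap C₂) := by
  rw [← specMatrix_comp, ← specMatrix_comp]
  congr 1
  exact LinearMap.ext hf

theorem MapHomogShift.matHomog_modU {C₁ C₂ : PreCx} {f : Msub C₁ →ₗ[RUV] Msub C₂} {s t : ℤ}
    (hf : MapHomogShift C₁ C₂ f s t) : MatHomog C₁.gr C₂.gr (specMatrix modU f) s t :=
  fun i j => (hf i j).modU.imp_right fun ⟨b, hb, h1, h2⟩ => ⟨b, hb, by omega, by omega⟩

theorem MapHomogShift.matHomog_modV {C₁ C₂ : PreCx} {f : Msub C₁ →ₗ[RUV] Msub C₂} {s t : ℤ}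
    (hf : MapHomogShift C₁ C₂ f s t) :
    MatHomog (fun i => (C₁.gr i).swap) (fun j => (C₂.gr j).swap) (specMatrix modV f) t s :=
  fun i j => (hf i j).modV.imp_right fun ⟨b, hb, h1, h2⟩ =>
    ⟨b, hb, by simp only [Prod.fst_swap]; omega, by simp only [Prod.snd_swap]; omega⟩

namespace IsSpecialization

variable {φ : RUV →+* F2X} {A B : RUV}

theorem map_aeval (S : IsSpecialization φ A B) (p : F2X) : φ (aeval B p) = p := by
  have : (φ.comp (aeval B : F2X →ₐ[ZMod 2] RUV).toRingHom) = RingHom.id F2X :=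
    Polynomial.ringHom_ext' (Subsingleton.elim _ _) (by simp [S.map_right])
  exact RingHom.congr_fun this p

theorem mem_range_iff (S : IsSpecialization φ A B) {n : ℕ} (x : Fin n →₀ RUV) :
    x ∈ LinearMap.range (LinearMap.lsmul RUV (Fin n →₀ RUV) A) ↔ specChain φ x = 0 := by
  constructor
  · rintro ⟨y, rfl⟩
    ext1 j
    simp [specChain, S.map_left]
  · intro hx
    choose t ht using S.decomp
    refine ⟨Finsupp.equivFunOnFinite.symm fun j => t (x j), ?_⟩
    ext1 j
    have h1 : φ (x j) = 0 := congrFun hx j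
    have h2 := ht (x j)
    rw [h1, map_zero, zero_add] at h2
    simpa using h2.symm

theorem exists_specChain_eq (S : IsSpecialization φ A B) {n : ℕ} (v : Fin n → F2X) :
    ∃ x : Fin n →₀ RUV, specChain φ x = v ∧ ∀ j, x j = aeval B (v j) :=
  ⟨Finsupp.equivFunOnFinite.symm fun j => aeval B (v j), by
    ext1 j; simp [specChain, S.map_aeval], fun j => rfl⟩

theorem specChain_pow_smul (S : IsSpecialization φ A B) {n : ℕ} (k : ℕ) (x : Fin n →₀ RUV) :
    specChain φ (B ^ k • x) = (X : F2X) ^ k • specChain φ x := by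
  ext1 j; simp [specChain, S.map_right]

theorem exists_pow_smul_mem_iff (S : IsSpecialization φ A B) {n : ℕ}
    (F : (Fin n →₀ RUV) →ₗ[RUV] (Fin n →₀ RUV)) (x : Fin n →₀ RUV) :
    (∃ k : ℕ, B ^ k • x ∈ LinearMap.range (LinearMap.lsmul RUV (Fin n →₀ RUV) A) ⊔
      LinearMap.range F) ↔ specChain φ x ∈ torsionChains (specMatrix φ F) := by
  refine exists_congr fun k => ?_
  rw [← S.specChain_pow_smul]
  constructor
  · intro h
    obtain ⟨a, ha, _, ⟨w, rfl⟩, h⟩ := Submodule.mem_sup.1 h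
    refine ⟨specChain φ w, ?_⟩
    rw [← h, ← specChain_map]
    ext1 j
    have : φ (a j) = 0 := congrFun ((S.mem_range_iff a).1 ha) j
    simp [specChain, this]
  · rintro ⟨v, hv⟩
    obtain ⟨w, rfl, -⟩ := S.exists_specChain_eq v
    refine Submodule.mem_sup.2 ⟨B ^ k • x - F w, (S.mem_range_iff _).2 ?_, F w, ⟨w, rfl⟩,
      sub_add_cancel _ _⟩
    rw [← specChain_map] at hv
    ext1 j
    have := congrFun hv j
    simp only [specChain] at this
    simp only [specChain, Finsupp.sub_apply, map_sub, this, sub_self, Pi.zero_apply]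

theorem isTowerGen_iff (S : IsSpecialization φ A B) {n : ℕ}
    (F : (Fin n →₀ RUV) →ₗ[RUV] (Fin n →₀ RUV)) (x : Fin n →₀ RUV) :
    (F x ∈ LinearMap.range (LinearMap.lsmul RUV (Fin n →₀ RUV) A) ∧
      (∀ k : ℕ, B ^ k • x ∉ LinearMap.range (LinearMap.lsmul RUV (Fin n →₀ RUV) A) ⊔
        LinearMap.range F) ∧
      ∀ z : Fin n →₀ RUV, F z ∈ LinearMap.range (LinearMap.lsmul RUV (Fin n →₀ RUV) A) →
        ∃ (r : RUV) (k : ℕ), B ^ k • (z - r • x) ∈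
          LinearMap.range (LinearMap.lsmul RUV (Fin n →₀ RUV) A) ⊔ LinearMap.range F) ↔
      IsTowerGen (specMatrix φ F) (specChain φ x) := by
  have hsub : ∀ (z : Fin n →₀ RUV) (r : RUV),
      specChain φ (z - r • x) = specChain φ z - φ r • specChain φ x := fun z r => by
    ext1 j; simp [specChain]
  simp only [S.mem_range_iff, S.exists_pow_smul_mem_iff, ← not_exists, specChain_map, hsub]
  constructor
  · rintro ⟨h1, h2, h3⟩
    refine ⟨h1, h2, fun v hv => ?_⟩
    obtain ⟨z, rfl, -⟩ := S.exists_specChain_eq v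
    obtain ⟨r, hr⟩ := h3 z hv
    exact ⟨φ r, hr⟩
  · rintro ⟨h1, h2, h3⟩
    refine ⟨h1, h2, fun z hz => ?_⟩
    obtain ⟨r, hr⟩ := h3 _ hz
    exact ⟨aeval B r, by rwa [S.map_aeval]⟩

end IsSpecialization

theorem isVTowerGen_iff {C : PreCx} {x : Msub C} :
    IsVTowerGen C x ↔ IsTowerGen (specMatrix modU (dmap C)) (specChain modU x) :=
  isSpecialization_modU.isTowerGen_iff (dmap C) x

theorem isUTowerGen_iff {C : PreCx} {x : Msub C} :
    IsUTowerGen C x ↔ IsTowerGen (specMatrix modV (dmap C)) (specChain modV x) :=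
  isSpecialization_modV.isTowerGen_iff (dmap C) x

/-- In a knot-like complex, a homogeneous chain which is a nontorsion cycle modulo `V` has
`V`-grading zero. -/
theorem IsKnotLike.gr_eq_zero_of_notMem {C : PreCx} (hC : IsKnotLike C) {x : Msub C} {p q : ℤ}
    (hx : ChainHomog C x p q) (hcyc : specChain modV x ᵥ* specMatrix modV (dmap C) = 0)
    (hnt : specChain modV x ∉ torsionChains (specMatrix modV (dmap C))) : q = 0 := by
  refine hC.uTowerGr x p q hx ?_ ?_
  · rw [← specChain_map] at hcyc
    exact (isSpecialization_modV.mem_range_iff _).2 hcyc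
  · rw [← isSpecialization_modV.exists_pow_smul_mem_iff] at hnt
    exact not_exists.1 hnt

theorem IsKnotLike.exists_homog_notMem {C : PreCx} (hC : IsKnotLike C) :
    ∃ (x : Msub C) (p q : ℤ), ChainHomog C x p q ∧
      specChain modV x ᵥ* specMatrix modV (dmap C) = 0 ∧
      specChain modV x ∉ torsionChains (specMatrix modV (dmap C)) := by
  obtain ⟨x₀, hx₀⟩ := hC.uTowerExists
  rw [isUTowerGen_iff] at hx₀
  obtain ⟨s, hs⟩ : ∃ s, chainComp (fun i => (C.gr i).swap) s (specChain modV x₀) ∉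
      torsionChains (specMatrix modV (dmap C)) := by
    by_contra! h
    exact hx₀.notMem (mem_of_chainComp_mem _ _ _ h)
  obtain ⟨x, hx, hxj⟩ := isSpecialization_modV.exists_specChain_eq
    (chainComp (fun i => (C.gr i).swap) s (specChain modV x₀))
  refine ⟨x, s.2, s.1, fun j => ?_, ?_, by rwa [hx]⟩
  · rw [hxj]
    rcases chainComp_apply (fun i => (C.gr i).swap) s (specChain modV x₀) j with h | ⟨k, h, h1, h2⟩
    · exact Or.inl (by rw [h, map_zero])
    · simp only [Prod.fst_swap, Prod.snd_swap] at h1 h2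
      exact Or.inr (Or.inl ⟨k, by rw [h, map_pow, aeval_X], by omega, by omega⟩)
  · rw [hx, ← chainComp_vecMul hC.dmap_homog.matHomog_modV, hx₀.cycle]
    ext1 j
    simp [chainComp, polyComp]

/-- A composite of local maps in both directions has degree zero, and acts as the identity on
the homology of `C/V` modulo torsion. -/
theorem IsLocalMap.comp_shift_eq_zero {C₁ C₂ : PreCx} (h₁ : IsKnotLike C₁)
    {f : Msub C₁ →ₗ[RUV] Msub C₂} {g : Msub C₂ →ₗ[RUV] Msub C₁} (hf : IsLocalMap C₁ C₂ f)
    (hg : IsLocalMap C₂ C₁ g) {s t : ℤ} (hfs : MapHomogShift C₁ C₂ f 0 s)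
    (hgt : MapHomogShift C₂ C₁ g 0 t) :
    s + t = 0 ∧ ∀ z, z ᵥ* specMatrix modV (dmap C₁) = 0 →
      z ᵥ* (specMatrix modV f * specMatrix modV g) - z ∈
        torsionChains (specMatrix modV (dmap C₁)) := by
  have hgf : MapHomogShift C₁ C₁ (g ∘ₗ f) 0 (s + t) := by simpa using hfs.comp hgt
  have hchain : ∀ x, (g ∘ₗ f) (dmap C₁ x) = dmap C₁ ((g ∘ₗ f) x) := fun x => by
    simp [hf.chain, hg.chain]
  have hdiag : ∀ i, IsHomog ((g ∘ₗ f) (Finsupp.single i 1) i) 0 (s + t) := fun i => by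
    simpa using hgf i i
  obtain ⟨x, hx⟩ := h₁.vTowerExists
  have hgfx := isVTowerGen_iff.1 (hg.towers _ (hf.towers x hx))
  rw [← LinearMap.comp_apply, specChain_map] at hgfx
  obtain ⟨hst, htr⟩ := trace_eq_one_of_isTowerGen (specMatrix_dmap_sq modU h₁)
    (specMatrix_commute modU hchain) h₁.dmap_homog.matHomog_modU (σ := s + t)
    (fun i => (hdiag i).modU.imp_right fun ⟨b, hb, _, h⟩ => ⟨b, hb, h⟩)
    (isVTowerGen_iff.1 hx) hgfx
  refine ⟨hst, fun z hz => ?_⟩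
  have hc : IsHomog (∑ i, (g ∘ₗ f) (Finsupp.single i 1) i) 0 0 :=
    IsHomog.sum _ fun i _ => hst ▸ hdiag i
  have htrace : ∀ φ : RUV →+* F2X, (specMatrix φ (g ∘ₗ f)).trace =
      φ (∑ i, (g ∘ₗ f) (Finsupp.single i 1) i) := fun φ => (map_sum φ _ _).symm
  have hc1 : ∑ i, (g ∘ₗ f) (Finsupp.single i 1) i = 1 := by
    rw [htrace] at htr
    rcases hc with h | ⟨a, h, ha, -⟩ | ⟨a, h, -, ha⟩
    · rw [h, map_zero] at htr
      exact absurd htr zero_ne_one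
    all_goals
      obtain rfl : a = 0 := by omega
      rw [h, pow_zero]
  obtain ⟨y, hy⟩ := h₁.uTowerExists
  rw [← specMatrix_comp]
  exact vecMul_sub_mem_torsionChains (specMatrix_dmap_sq modV h₁)
    (specMatrix_commute modV hchain) (by rw [htrace, hc1, map_one]) (isUTowerGen_iff.1 hy) hz

end

/-- Let `C₁` and `C₂` be knot-like complexes which are locally
equivalent via local maps `f : C₁ → C₂` and `g : C₂ → C₁`.  Then `f` and `g` also
induce isomorphisms on `H_*(·/V)/(U-torsion)`; in particular, they send `U`-tower
classes to `U`-tower classes and are absolutely `V`-graded. -/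
theorem local_equivalences_respect_U_towers (C₁ C₂ : PreCx)
    (h₁ : IsKnotLike C₁) (h₂ : IsKnotLike C₂)
    (f : Msub C₁ →ₗ[RUV] Msub C₂) (g : Msub C₂ →ₗ[RUV] Msub C₁)
    (hf : IsLocalMap C₁ C₂ f) (hg : IsLocalMap C₂ C₁ g) :
    (∀ x : Msub C₁, IsUTowerGen C₁ x → IsUTowerGen C₂ (f x)) ∧
    (∀ y : Msub C₂, IsUTowerGen C₂ y → IsUTowerGen C₁ (g y)) ∧
    MapHomogShift C₁ C₂ f 0 0 ∧ MapHomogShift C₂ C₁ g 0 0 := by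
  obtain ⟨s, hfs⟩ := hf.graded
  obtain ⟨t, hgt⟩ := hg.graded
  obtain ⟨hst, hgf⟩ := hf.comp_shift_eq_zero h₁ hg hfs hgt
  obtain ⟨-, hfg⟩ := hg.comp_shift_eq_zero h₂ hf hgt hfs
  have hfc := specMatrix_commute modV hf.chain
  have hgc := specMatrix_commute modV hg.chain
  obtain ⟨x, p, q, hx, hcyc, hnt⟩ := h₁.exists_homog_notMem
  have hq := h₁.gr_eq_zero_of_notMem hx hcyc hnt
  have hqs := h₂.gr_eq_zero_of_notMem (hfs.chainHomog hx)
    (by rw [specChain_map, Matrix.vecMul_vecMul, ← hfc, ← Matrix.vecMul_vecMul, hcyc,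
      Matrix.zero_vecMul])
    (fun h => by
      have h1 := torsionChains_map hgc h
      rw [specChain_map, Matrix.vecMul_vecMul] at h1
      exact hnt (by simpa using sub_mem h1 (hgf _ hcyc)))
  obtain rfl : s = 0 := by omega
  obtain rfl : t = 0 := by omega
  refine ⟨fun x hx => ?_, fun y hy => ?_, hfs, hgt⟩
  · rw [isUTowerGen_iff, specChain_map]
    exact (isUTowerGen_iff.1 hx).map hfc hgc hgf hfg
  · rw [isUTowerGen_iff, specChain_map]
    exact (isUTowerGen_iff.1 hy).map hgc hfc hfg hgf
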